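/- arXiv:1907.03631 — 3 statements merged into one kernel-verified Lean document; each statement's English description precedes it below -/
import Mathlib

section
/- Substitution Lemma: if the sequents Σ ⇒ t:A, Θ and Γ, x:A ⇒ Δ are both derivable in NMLL and share no variable, then the sequent Γ, Σ ⇒ Δ[t/x], Θ is derivable in NMLL, where Δ[t/x] denotes the replacement of all occurrences of x in all terms of Δ by t. -/
/- Types of multiplicative linear logic: propositional variables, ⊥, ⊸, ⅋ -/
inductive Ty : Type
  | pvar : ℕ → Ty
  | bot : Ty
  | limp : Ty → Ty → Ty
  | parr : Ty → Ty → Ty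
  deriving DecidableEq

/- Untyped terms of λ∥ -/
inductive Tm : Type
  | unit : Tm                    -- ∘ (terminated process)
  | out : ℕ → Tm → Tm            -- x̄ u (output channel with continuation; λx u when x occurs in u)
  | out2 : ℕ → ℕ → Tm → Tm       -- x̄ȳ u (output channels without continuation)
  | par : Tm → Tm → Tm           -- u ∣ v
  | close : Tm → Tm              -- close(u)
  | var : ℕ → Tm                 -- variable x
  | app : Tm → Tm → Tm           -- application u v
  deriving DecidableEq

namespace Tm

/-- number of occurrences of the variable (input channel) x in a term -/
def varOcc (x : ℕ) : Tm → ℕ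
  | unit => 0
  | out _ u => varOcc x u
  | out2 _ _ u => varOcc x u
  | par u v => varOcc x u + varOcc x v
  | close u => varOcc x u
  | var y => if y = x then 1 else 0
  | app u v => varOcc x u + varOcc x v

/-- number of occurrences of the output binder x̄ in a term -/
def outOcc (x : ℕ) : Tm → ℕ
  | unit => 0
  | out y u => (if y = x then 1 else 0) + outOcc x u
  | out2 y z u => (if y = x then 1 else 0) + (if z = x then 1 else 0) + outOcc x u
  | par u v => outOcc x u + outOcc x v
  | close u => outOcc x u
  | var _ => 0
  | app u v => outOcc x u + outOcc x v

/-- literal substitution of the term v for the variable x (no renaming) -/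
def subst (x : ℕ) (v : Tm) : Tm → Tm
  | unit => unit
  | out y u => out y (subst x v u)
  | out2 y z u => out2 y z (subst x v u)
  | par u w => par (subst x v u) (subst x v w)
  | close u => close (subst x v u)
  | var y => if y = x then v else var y
  | app u w => app (subst x v u) (subst x v w)

/-- communication-size: number of occurrences of the operators x̄ and x̄ȳ -/
def cs : Tm → ℕ
  | unit => 0
  | out _ u => cs u + 1
  | out2 _ _ u => cs u + 1
  | par u v => cs u + cs v
  | close u => cs u
  | var _ => 0
  | app u v => cs u + cs v

/-- values: terms of the form x̄ t or s ∣ t -/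
def IsValue : Tm → Prop
  | out _ _ => True
  | par _ _ => True
  | _ => False

end Tm

/- one-hole contexts -/
inductive Ctx : Type
  | hole : Ctx
  | out : ℕ → Ctx → Ctx
  | out2 : ℕ → ℕ → Ctx → Ctx
  | parL : Ctx → Tm → Ctx
  | parR : Tm → Ctx → Ctx
  | close : Ctx → Ctx
  | appL : Ctx → Tm → Ctx
  | appR : Tm → Ctx → Ctx

namespace Ctx

def fill : Ctx → Tm → Tm
  | hole, t => t
  | out x C, t => Tm.out x (fill C t)
  | out2 x y C, t => Tm.out2 x y (fill C t)
  | parL C u, t => Tm.par (fill C t) u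
  | parR u C, t => Tm.par u (fill C t)
  | close C, t => Tm.close (fill C t)
  | appL C u, t => Tm.app (fill C t) u
  | appR u C, t => Tm.app u (fill C t)

/-- a context is simple if it has no subterm of the form D[ ]∣u or u∣D[ ] -/
def Simple : Ctx → Prop
  | hole => True
  | out _ C => Simple C
  | out2 _ _ C => Simple C
  | parL _ _ => False
  | parR _ _ => False
  | close C => Simple C
  | appL C _ => Simple C
  | appR _ C => Simple C

/-- occurrences of the variable x in the context (not counting the hole) -/
def varOcc (x : ℕ) : Ctx → ℕ
  | hole => 0
  | out _ C => varOcc x C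
  | out2 _ _ C => varOcc x C
  | parL C u => varOcc x C + Tm.varOcc x u
  | parR u C => Tm.varOcc x u + varOcc x C
  | close C => varOcc x C
  | appL C u => varOcc x C + Tm.varOcc x u
  | appR u C => Tm.varOcc x u + varOcc x C

end Ctx

/- two-hole contexts D[ ][ ] -/
inductive Ctx2 : Type
  | out : ℕ → Ctx2 → Ctx2
  | out2 : ℕ → ℕ → Ctx2 → Ctx2
  | close : Ctx2 → Ctx2
  | parLL : Ctx2 → Tm → Ctx2
  | parRR : Tm → Ctx2 → Ctx2
  | parLR : Ctx → Ctx → Ctx2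
  | parRL : Ctx → Ctx → Ctx2
  | appLL : Ctx2 → Tm → Ctx2
  | appRR : Tm → Ctx2 → Ctx2
  | appLR : Ctx → Ctx → Ctx2
  | appRL : Ctx → Ctx → Ctx2

def Ctx2.fill : Ctx2 → Tm → Tm → Tm
  | .out x C, a, b => Tm.out x (Ctx2.fill C a b)
  | .out2 x y C, a, b => Tm.out2 x y (Ctx2.fill C a b)
  | .close C, a, b => Tm.close (Ctx2.fill C a b)
  | .parLL C u, a, b => Tm.par (Ctx2.fill C a b) u
  | .parRR u C, a, b => Tm.par u (Ctx2.fill C a b)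
  | .parLR C D, a, b => Tm.par (Ctx.fill C a) (Ctx.fill D b)
  | .parRL C D, a, b => Tm.par (Ctx.fill C b) (Ctx.fill D a)
  | .appLL C u, a, b => Tm.app (Ctx2.fill C a b) u
  | .appRR u C, a, b => Tm.app u (Ctx2.fill C a b)
  | .appLR C D, a, b => Tm.app (Ctx.fill C a) (Ctx.fill D b)
  | .appRL C D, a, b => Tm.app (Ctx.fill C b) (Ctx.fill D a)

/- one-step reduction of λ∥ -/
inductive Step : Tm → Tm → Prop
  /- β-reduction (λx u)t ↦ u[t/x], where λx u is x̄u with x occurring in u -/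
  | beta (x : ℕ) (u t : Tm) (hx : 0 < Tm.varOcc x u) :
      Step (Tm.app (Tm.out x u) t) (Tm.subst x t u)
  /- communication C[x̄⟨s⟩u] ∣ D[x] ↦ C[s] ∣ D[u] -/
  | comm1 (C D : Ctx) (x : ℕ) (s u : Tm) :
      Step (Tm.par (C.fill (Tm.app (Tm.out x s) u)) (D.fill (Tm.var x)))
           (Tm.par (C.fill s) (D.fill u))
  /- communication C[x] ∣ D[x̄⟨s⟩u] ↦ C[u] ∣ D[s] -/
  | comm2 (C D : Ctx) (x : ℕ) (s u : Tm) :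
      Step (Tm.par (C.fill (Tm.var x)) (D.fill (Tm.app (Tm.out x s) u)))
           (Tm.par (C.fill u) (D.fill s))
  /- C[x̄ȳ(s∣t)] ∣ D[x][y] ↦ C[∘] ∣ D[s][t] -/
  | pa1 (C : Ctx) (D : Ctx2) (x y : ℕ) (s t : Tm) :
      Step (Tm.par (C.fill (Tm.out2 x y (Tm.par s t))) (D.fill (Tm.var x) (Tm.var y)))
           (Tm.par (C.fill Tm.unit) (D.fill s t))
  /- D[x][y] ∣ C[x̄ȳ(s∣t)] ↦ D[s][t] ∣ C[∘] -/
  | pa2 (C : Ctx) (D : Ctx2) (x y : ℕ) (s t : Tm) :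
      Step (Tm.par (D.fill (Tm.var x) (Tm.var y)) (C.fill (Tm.out2 x y (Tm.par s t))))
           (Tm.par (D.fill s t) (C.fill Tm.unit))
  /- D[x] ∣ C[x̄ȳ(s∣t)] ∣ E[y] ↦ D[s] ∣ C[∘] ∣ E[t]  (both associations) -/
  | pa3l (C D E : Ctx) (x y : ℕ) (s t : Tm) :
      Step (Tm.par (Tm.par (D.fill (Tm.var x)) (C.fill (Tm.out2 x y (Tm.par s t)))) (E.fill (Tm.var y)))
           (Tm.par (Tm.par (D.fill s) (C.fill Tm.unit)) (E.fill t))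
  | pa3r (C D E : Ctx) (x y : ℕ) (s t : Tm) :
      Step (Tm.par (D.fill (Tm.var x)) (Tm.par (C.fill (Tm.out2 x y (Tm.par s t))) (E.fill (Tm.var y))))
           (Tm.par (D.fill s) (Tm.par (C.fill Tm.unit) (E.fill t)))
  /- D[y] ∣ C[x̄ȳ(s∣t)] ∣ E[x] ↦ D[t] ∣ C[∘] ∣ E[s]  (both associations) -/
  | pa4l (C D E : Ctx) (x y : ℕ) (s t : Tm) :
      Step (Tm.par (Tm.par (D.fill (Tm.var y)) (C.fill (Tm.out2 x y (Tm.par s t)))) (E.fill (Tm.var x)))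
           (Tm.par (Tm.par (D.fill t) (C.fill Tm.unit)) (E.fill s))
  | pa4r (C D E : Ctx) (x y : ℕ) (s t : Tm) :
      Step (Tm.par (D.fill (Tm.var y)) (Tm.par (C.fill (Tm.out2 x y (Tm.par s t))) (E.fill (Tm.var x))))
           (Tm.par (D.fill t) (Tm.par (C.fill Tm.unit) (E.fill s)))
  /- closure under arbitrary contexts -/
  | ctx (C : Ctx) {t u : Tm} (h : Step t u) : Step (C.fill t) (C.fill u)

/-- a term is normal if no reduction applies to it -/
def NormalTm (t : Tm) : Prop := ∀ u, ¬ Step t u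

/-- parallel composition t₁ ∣ … ∣ tₘ of a list of terms -/
def bigPar : List Tm → Tm
  | [] => Tm.unit
  | t :: ts => ts.foldl Tm.par t

/- entries of the right-hand side of an NMLL sequent: a term with an optional type -/
abbrev Entry := Tm × Option Ty

/-- the variable z is used in the sequent Γ ⇒ Δ (declared in Γ, or occurring
    as a variable or as an output binder in a term of Δ) -/
def UsedIn (Γ : Multiset (ℕ × Ty)) (Δ : Multiset Entry) (z : ℕ) : Prop :=
  (∃ A, (z, A) ∈ Γ) ∨ ∃ e ∈ Δ, 0 < Tm.varOcc z e.1 ∨ 0 < Tm.outOcc z e.1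

/-- two sequents share no variable -/
def SeqDisj (Γ₁ : Multiset (ℕ × Ty)) (Δ₁ : Multiset Entry)
    (Γ₂ : Multiset (ℕ × Ty)) (Δ₂ : Multiset Entry) : Prop :=
  ∀ z, ¬ (UsedIn Γ₁ Δ₁ z ∧ UsedIn Γ₂ Δ₂ z)

/- the multiple-conclusion natural deduction typing system NMLL -/
inductive NMLL : Multiset (ℕ × Ty) → Multiset Entry → Type
  | ax (x : ℕ) (A : Ty) : NMLL {(x, A)} {(Tm.var x, some A)}
  /- ⊸I (both variants: x occurs in t, or x occurs in Δ) -/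
  | limpI {Γ : Multiset (ℕ × Ty)} {Δ : Multiset Entry} (x : ℕ) (A B : Ty) (t : Tm)
      (d : NMLL ((x, A) ::ₘ Γ) ((t, some B) ::ₘ Δ))
      (hx : 0 < Tm.varOcc x t ∨ ∃ e ∈ Δ, 0 < Tm.varOcc x e.1) :
      NMLL Γ ((Tm.out x t, some (Ty.limp A B)) ::ₘ Δ)
  /- ⊸E -/
  | limpE {Γ Φ : Multiset (ℕ × Ty)} {Δ Θ : Multiset Entry} (s t : Tm) (A B : Ty)
      (d1 : NMLL Γ ((s, some (Ty.limp A B)) ::ₘ Δ))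
      (d2 : NMLL Φ ((t, some A) ::ₘ Θ))
      (h : SeqDisj Γ ((s, some (Ty.limp A B)) ::ₘ Δ) Φ ((t, some A) ::ₘ Θ)) :
      NMLL (Γ + Φ) ((Tm.app s t, some B) ::ₘ (Δ + Θ))
  /- ⅋I -/
  | parrI {Γ : Multiset (ℕ × Ty)} {Δ : Multiset Entry} (s t : Tm) (A B : Ty)
      (d : NMLL Γ ((s, some A) ::ₘ (t, some B) ::ₘ Δ)) :
      NMLL Γ ((Tm.par s t, some (Ty.parr A B)) ::ₘ Δ)
  /- ⅋E -/
  | parrE {Γ Φ₁ Φ₂ : Multiset (ℕ × Ty)} {Δ Θ₁ Θ₂ : Multiset Entry}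
      (s : Tm) (x y : ℕ) (A B : Ty)
      (d1 : NMLL Γ ((s, some (Ty.parr A B)) ::ₘ Δ))
      (d2 : NMLL ((x, A) ::ₘ Φ₁) Θ₁)
      (d3 : NMLL ((y, B) ::ₘ Φ₂) Θ₂)
      (h12 : SeqDisj Γ ((s, some (Ty.parr A B)) ::ₘ Δ) ((x, A) ::ₘ Φ₁) Θ₁)
      (h13 : SeqDisj Γ ((s, some (Ty.parr A B)) ::ₘ Δ) ((y, B) ::ₘ Φ₂) Θ₂)
      (h23 : SeqDisj ((x, A) ::ₘ Φ₁) Θ₁ ((y, B) ::ₘ Φ₂) Θ₂) :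
      NMLL (Γ + Φ₁ + Φ₂) ((Tm.out2 x y s, some Ty.bot) ::ₘ (Δ + Θ₁ + Θ₂))
  /- ⊥I -/
  | botI {Γ : Multiset (ℕ × Ty)} {Δ : Multiset Entry} (d : NMLL Γ Δ) :
      NMLL Γ ((Tm.unit, some Ty.bot) ::ₘ Δ)
  /- ⊥E -/
  | botE {Γ : Multiset (ℕ × Ty)} {Δ : Multiset Entry} (t : Tm)
      (d : NMLL Γ ((t, some Ty.bot) ::ₘ Δ)) :
      NMLL Γ ((Tm.close t, none) ::ₘ Δ)

/- the two-sided sequent calculus MLL for classical multiplicative linear logic -/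
inductive MLL : Multiset Ty → Multiset Ty → Prop
  | ax (A : Ty) : MLL {A} {A}
  | botL : MLL {Ty.bot} 0
  | botR {Γ Δ : Multiset Ty} (h : MLL Γ Δ) : MLL Γ (Ty.bot ::ₘ Δ)
  | limpL {Γ Φ Δ Θ : Multiset Ty} {A B : Ty}
      (h1 : MLL Γ (A ::ₘ Δ)) (h2 : MLL (B ::ₘ Φ) Θ) :
      MLL (Ty.limp A B ::ₘ (Γ + Φ)) (Δ + Θ)
  | limpR {Γ Δ : Multiset Ty} {A B : Ty} (h : MLL (A ::ₘ Γ) (B ::ₘ Δ)) :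
      MLL Γ (Ty.limp A B ::ₘ Δ)
  | parrL {Γ Φ Δ Θ : Multiset Ty} {A B : Ty}
      (h1 : MLL (A ::ₘ Γ) Δ) (h2 : MLL (B ::ₘ Φ) Θ) :
      MLL (Ty.parr A B ::ₘ (Γ + Φ)) (Δ + Θ)
  | parrR {Γ Δ : Multiset Ty} {A B : Ty} (h : MLL Γ (A ::ₘ B ::ₘ Δ)) :
      MLL Γ (Ty.parr A B ::ₘ Δ)
  | cut {Γ Φ Δ Θ : Multiset Ty} {A : Ty}
      (h1 : MLL Γ (A ::ₘ Δ)) (h2 : MLL (A ::ₘ Φ) Θ) :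
      MLL (Γ + Φ) (Δ + Θ)

/-- the subformula relation on types (reflexive-transitive closure of immediate subformula) -/
inductive Subformula : Ty → Ty → Prop
  | refl (A : Ty) : Subformula A A
  | limpL {S A B : Ty} (h : Subformula S A) : Subformula S (Ty.limp A B)
  | limpR {S A B : Ty} (h : Subformula S B) : Subformula S (Ty.limp A B)
  | parrL {S A B : Ty} (h : Subformula S A) : Subformula S (Ty.parr A B)
  | parrR {S A B : Ty} (h : Subformula S B) : Subformula S (Ty.parr A B)

/-- the types occurring in a sequent -/
def seqTys (Γ : Multiset (ℕ × Ty)) (Δ : Multiset Entry) : Multiset Ty :=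
  Γ.map Prod.snd + Δ.filterMap Prod.snd

/-- all types occurring (in some sequent) in a derivation -/
def NMLL.tys : {Γ : Multiset (ℕ × Ty)} → {Δ : Multiset Entry} → NMLL Γ Δ → Multiset Ty
  | _, _, @NMLL.ax x A => seqTys {(x, A)} {(Tm.var x, some A)}
  | _, _, @NMLL.limpI Γ Δ x A B t d _ =>
      seqTys Γ ((Tm.out x t, some (Ty.limp A B)) ::ₘ Δ) + d.tys
  | _, _, @NMLL.limpE Γ Φ Δ Θ s t A B d1 d2 _ =>
      seqTys (Γ + Φ) ((Tm.app s t, some B) ::ₘ (Δ + Θ)) + d1.tys + d2.tys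
  | _, _, @NMLL.parrI Γ Δ s t A B d =>
      seqTys Γ ((Tm.par s t, some (Ty.parr A B)) ::ₘ Δ) + d.tys
  | _, _, @NMLL.parrE Γ Φ₁ Φ₂ Δ Θ₁ Θ₂ s x y A B d1 d2 d3 _ _ _ =>
      seqTys (Γ + Φ₁ + Φ₂) ((Tm.out2 x y s, some Ty.bot) ::ₘ (Δ + Θ₁ + Θ₂))
        + d1.tys + d2.tys + d3.tys
  | _, _, @NMLL.botI Γ Δ d => seqTys Γ ((Tm.unit, some Ty.bot) ::ₘ Δ) + d.tys
  | _, _, @NMLL.botE Γ Δ t d => seqTys Γ ((Tm.close t, none) ::ₘ Δ) + d.tys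

/-- total number of occurrences of the variable x in the terms of Δ -/
def varOccM (x : ℕ) (Δ : Multiset Entry) : ℕ := (Δ.map (fun e => Tm.varOcc x e.1)).sum

/-- total number of occurrences of the output binder x̄ in the terms of Δ -/
def outOccM (x : ℕ) (Δ : Multiset Entry) : ℕ := (Δ.map (fun e => Tm.outOcc x e.1)).sum

namespace Tm

theorem subst_eq_self {x : ℕ} {t : Tm} : ∀ {u : Tm}, varOcc x u = 0 → subst x t u = u := by
  intro u
  induction u <;> simp_all [varOcc, subst]

theorem varOcc_subst_pos {x z : ℕ} {t u : Tm} (h : 0 < varOcc z (subst x t u)) :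
    0 < varOcc z u ∨ 0 < varOcc z t := by
  induction u with
  | var y =>
    by_cases hy : y = x
    · simp_all [subst]
    · simp_all [subst]
  | _ =>
    simp only [varOcc, subst] at *
    grind

theorem outOcc_subst_pos {x z : ℕ} {t u : Tm} (h : 0 < outOcc z (subst x t u)) :
    0 < outOcc z u ∨ 0 < outOcc z t := by
  induction u with
  | var y =>
    by_cases hy : y = x
    · simp_all [subst]
    · simp_all [subst]
  | _ =>
    simp only [outOcc, subst] at *
    grind

theorem varOcc_pos_subst {x z : ℕ} {t u : Tm} (hzx : z ≠ x) (h : 0 < varOcc z u) :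
    0 < varOcc z (subst x t u) := by
  induction u with
  | var y =>
    have hy : y = z := by
      by_contra hne
      simp [varOcc, hne] at h
    subst hy
    simp [subst, hzx, varOcc]
  | _ =>
    simp only [varOcc, subst] at *
    grind

end Tm

/-- The substitution of `t` for `x` in every term of a right-hand side. -/
abbrev substM (x : ℕ) (t : Tm) (Δ : Multiset Entry) : Multiset Entry :=
  Δ.map (fun e => (Tm.subst x t e.1, e.2))

theorem substM_eq_self {x : ℕ} {t : Tm} {Γ : Multiset (ℕ × Ty)} {Δ : Multiset Entry}
    (h : ¬ UsedIn Γ Δ x) : substM x t Δ = Δ := by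
  conv_rhs => rw [← Multiset.map_id Δ]
  refine Multiset.map_congr rfl fun e he => ?_
  have h0 : Tm.varOcc x e.1 = 0 := by
    by_contra hne
    exact h (Or.inr ⟨e, he, Or.inl (Nat.pos_of_ne_zero hne)⟩)
  simp [Tm.subst_eq_self h0]

theorem subst_eq_self_of_cons {x : ℕ} {t u : Tm} {B : Option Ty} {Γ : Multiset (ℕ × Ty)}
    {Δ : Multiset Entry} (h : ¬ UsedIn Γ ((u, B) ::ₘ Δ) x) :
    Tm.subst x t u = u ∧ substM x t Δ = Δ := by
  have hs := substM_eq_self (t := t) h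
  have hu : Tm.subst x t u = u := by
    refine Tm.subst_eq_self ?_
    by_contra hne
    exact h (Or.inr ⟨_, Multiset.mem_cons_self _ _, Or.inl (Nat.pos_of_ne_zero hne)⟩)
  simp only [substM, Multiset.map_cons, hu, Multiset.cons_inj_right] at hs
  exact ⟨hu, hs⟩

theorem usedIn_add {Γ Φ : Multiset (ℕ × Ty)} {Δ Θ : Multiset Entry} {z : ℕ} :
    UsedIn (Γ + Φ) (Δ + Θ) z ↔ UsedIn Γ Δ z ∨ UsedIn Φ Θ z := by
  simp only [UsedIn, Multiset.mem_add]
  grind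

theorem UsedIn.of_substM {Γ Φ : Multiset (ℕ × Ty)} {Δ Θ : Multiset Entry} {x z : ℕ} {t : Tm}
    {A : Ty} (h : UsedIn (Γ + Φ) (substM x t Δ + Θ) z) :
    UsedIn Φ ((t, some A) ::ₘ Θ) z ∨ UsedIn ((x, A) ::ₘ Γ) Δ z := by
  rcases usedIn_add.1 h with (⟨B, hB⟩ | ⟨e, he, hz⟩) | (⟨B, hB⟩ | ⟨e, he, hz⟩)
  · exact Or.inr (Or.inl ⟨B, Multiset.mem_cons_of_mem hB⟩)
  · obtain ⟨e', he', rfl⟩ := Multiset.mem_map.1 he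
    rcases hz with hz | hz
    · rcases Tm.varOcc_subst_pos hz with hz | hz
      · exact Or.inr (Or.inr ⟨e', he', Or.inl hz⟩)
      · exact Or.inl (Or.inr ⟨_, Multiset.mem_cons_self _ _, Or.inl hz⟩)
    · rcases Tm.outOcc_subst_pos hz with hz | hz
      · exact Or.inr (Or.inr ⟨e', he', Or.inr hz⟩)
      · exact Or.inl (Or.inr ⟨_, Multiset.mem_cons_self _ _, Or.inr hz⟩)
  · exact Or.inl (Or.inl ⟨B, hB⟩)
  · exact Or.inl (Or.inr ⟨e, Multiset.mem_cons_of_mem he, hz⟩)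

theorem SeqDisj.symm {Γ Φ : Multiset (ℕ × Ty)} {Δ Θ : Multiset Entry}
    (h : SeqDisj Γ Δ Φ Θ) : SeqDisj Φ Θ Γ Δ := fun z hz => h z ⟨hz.2, hz.1⟩

theorem SeqDisj.mono_right {Γ Φ Φ' : Multiset (ℕ × Ty)} {Δ Θ Θ' : Multiset Entry}
    (h : SeqDisj Γ Δ Φ Θ) (hsub : ∀ z, UsedIn Φ' Θ' z → UsedIn Φ Θ z) :
    SeqDisj Γ Δ Φ' Θ' := fun z hz => h z ⟨hz.1, hsub z hz.2⟩

theorem SeqDisj.substM_left {Γ Φ Ψ : Multiset (ℕ × Ty)} {Δ Θ Ξ : Multiset Entry} {x : ℕ} {t : Tm}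
    {A : Ty} (h : SeqDisj Φ ((t, some A) ::ₘ Θ) Ψ Ξ) (h' : SeqDisj ((x, A) ::ₘ Γ) Δ Ψ Ξ) :
    SeqDisj (Γ + Φ) (substM x t Δ + Θ) Ψ Ξ := fun z hz =>
  hz.1.of_substM.elim (fun hu => h z ⟨hu, hz.2⟩) (fun hu => h' z ⟨hu, hz.2⟩)

theorem SeqDisj.not_usedIn {Γ Ψ : Multiset (ℕ × Ty)} {Δ Ξ : Multiset Entry} {x : ℕ}
    {A : Ty} (h : SeqDisj ((x, A) ::ₘ Γ) Δ Ψ Ξ) : ¬ UsedIn Ψ Ξ x := fun hx =>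
  h x ⟨Or.inl ⟨A, Multiset.mem_cons_self _ _⟩, hx⟩

theorem SeqDisj.disjoint_fst {Γ Φ : Multiset (ℕ × Ty)} {Δ Θ : Multiset Entry}
    (h : SeqDisj Γ Δ Φ Θ) : Disjoint (Γ.map Prod.fst) (Φ.map Prod.fst) := by
  rw [Multiset.disjoint_left]
  intro z hz hz'
  obtain ⟨⟨_, B⟩, hB, rfl⟩ := Multiset.mem_map.1 hz
  obtain ⟨⟨_, C⟩, hC, rfl⟩ := Multiset.mem_map.1 hz'
  exact h _ ⟨Or.inl ⟨B, hB⟩, Or.inl ⟨C, hC⟩⟩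

theorem NMLL.nodup_fst {Γ : Multiset (ℕ × Ty)} {Δ : Multiset Entry} (d : NMLL Γ Δ) :
    (Γ.map Prod.fst).Nodup := by
  induction d with
  | ax => simp
  | limpI y B C s d hy ih => exact (Multiset.nodup_cons.1 (by simpa using ih)).2
  | limpE s u B C d1 d2 h ih1 ih2 =>
    rw [Multiset.map_add]
    exact (Multiset.Nodup.add_iff ih1 ih2).2 h.disjoint_fst
  | parrI s u B C d ih => exact ih
  | parrE s y w B C d1 d2 d3 h12 h13 h23 ih1 ih2 ih3 =>
    have e12 := h12.disjoint_fst
    have e13 := h13.disjoint_fst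
    have e23 := h23.disjoint_fst
    simp only [Multiset.map_cons, Multiset.nodup_cons, Multiset.disjoint_cons_left,
      Multiset.disjoint_cons_right] at ih2 ih3 e12 e13 e23
    simp only [Multiset.map_add]
    refine (Multiset.Nodup.add_iff ((Multiset.Nodup.add_iff ih1 ih2.2).2 e12.2) ih3.2).2 ?_
    exact Multiset.disjoint_add_left.2 ⟨e13.2, e23.2.2⟩
  | botI d ih => exact ih
  | botE u d ih => exact ih

theorem NMLL.nonempty_congr {Γ Γ' : Multiset (ℕ × Ty)} {Δ Δ' : Multiset Entry}
    (d : NMLL Γ Δ) (hΓ : Γ = Γ') (hΔ : Δ = Δ') : Nonempty (NMLL Γ' Δ') := by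
  subst hΓ hΔ
  exact ⟨d⟩

theorem Multiset.cons_eq_add_cases {α : Type*} {a : α} {s u v : Multiset α} (h : u + v = a ::ₘ s) :
    (∃ u', u = a ::ₘ u' ∧ s = u' + v) ∨ ∃ v', v = a ::ₘ v' ∧ s = u + v' := by
  have ha : a ∈ u + v := h ▸ Multiset.mem_cons_self a s
  rcases Multiset.mem_add.1 ha with hu | hv
  · obtain ⟨u', rfl⟩ := Multiset.exists_cons_of_mem hu
    exact Or.inl ⟨u', rfl, by simpa using h.symm⟩
  · obtain ⟨v', rfl⟩ := Multiset.exists_cons_of_mem hv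
    exact Or.inr ⟨v', rfl, by simpa using h.symm⟩

theorem NMLL.nonempty_subst {Φ : Multiset (ℕ × Ty)} {Θ : Multiset Entry} {t : Tm} {A : Ty} {x : ℕ}
    (d : NMLL Φ ((t, some A) ::ₘ Θ)) {Ψ : Multiset (ℕ × Ty)} {Δ : Multiset Entry} (d' : NMLL Ψ Δ) :
    ∀ Γ, Ψ = (x, A) ::ₘ Γ → SeqDisj Φ ((t, some A) ::ₘ Θ) Ψ Δ →
      Nonempty (NMLL (Γ + Φ) (substM x t Δ + Θ)) := by
  induction d' with
  | ax y B =>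
    rintro Γ hΓ -
    obtain ⟨hy, rfl⟩ := (Multiset.singleton_eq_cons_iff _).1 hΓ
    cases hy
    exact d.nonempty_congr (by simp) (by simp [Tm.subst])
  | @limpI Ψ Δ y B C s d' hy ih =>
    rintro Γ rfl h
    have hyx : y ≠ x := by
      have := d'.nodup_fst
      simp only [Multiset.map_cons, Multiset.nodup_cons, Multiset.mem_cons, not_or] at this
      exact this.1.1
    obtain ⟨e⟩ := ih ((y, B) ::ₘ Γ) (Multiset.cons_swap _ _ _) (h.mono_right (by
      intro z
      simp only [UsedIn, Multiset.mem_cons, exists_eq_or_imp, Tm.varOcc, Tm.outOcc]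
      grind))
    simp only [substM, Multiset.map_cons, Multiset.cons_add] at e ⊢
    refine ⟨.limpI y B C _ e (hy.imp (Tm.varOcc_pos_subst hyx) ?_)⟩
    rintro ⟨f, hf, hpos⟩
    exact ⟨_, Multiset.mem_add.2 (Or.inl (Multiset.mem_map_of_mem _ hf)),
      Tm.varOcc_pos_subst hyx hpos⟩
  | @limpE Ψ₁ Ψ₂ Δ₁ Δ₂ s u B C d1 d2 h12 ih1 ih2 =>
    rintro Γ hΓ h
    have h1 : SeqDisj Φ ((t, some A) ::ₘ Θ) Ψ₁ ((s, some (Ty.limp B C)) ::ₘ Δ₁) :=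
      h.mono_right (by
        intro z
        simp only [UsedIn, Multiset.mem_cons, Multiset.mem_add, exists_eq_or_imp, Tm.varOcc,
          Tm.outOcc]
        grind)
    have h2 : SeqDisj Φ ((t, some A) ::ₘ Θ) Ψ₂ ((u, some B) ::ₘ Δ₂) :=
      h.mono_right (by
        intro z
        simp only [UsedIn, Multiset.mem_cons, Multiset.mem_add, exists_eq_or_imp, Tm.varOcc,
          Tm.outOcc]
        grind)
    rcases Multiset.cons_eq_add_cases hΓ with ⟨Γ', rfl, rfl⟩ | ⟨Γ', rfl, rfl⟩
    · obtain ⟨e⟩ := ih1 Γ' rfl h1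
      have hd := h2.substM_left h12
      obtain ⟨hu, hs⟩ := subst_eq_self_of_cons (t := t) h12.not_usedIn
      simp only [substM, Multiset.map_cons, Multiset.cons_add, Multiset.map_add] at e hd hs ⊢
      refine (NMLL.limpE _ _ _ _ e d2 hd).nonempty_congr (by abel) ?_
      rw [Tm.subst, hu, hs, add_right_comm]
    · obtain ⟨e⟩ := ih2 Γ' rfl h2
      have hd := (h1.substM_left h12.symm).symm
      obtain ⟨hu, hs⟩ := subst_eq_self_of_cons (t := t) h12.symm.not_usedIn
      simp only [substM, Multiset.map_cons, Multiset.cons_add, Multiset.map_add] at e hd hs ⊢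
      refine (NMLL.limpE _ _ _ _ d1 e hd).nonempty_congr (by abel) ?_
      rw [Tm.subst, hu, hs, add_assoc]
  | parrI s u B C d' ih =>
    rintro Γ rfl h
    obtain ⟨e⟩ := ih Γ rfl (h.mono_right (by
      intro z
      simp only [UsedIn, Multiset.mem_cons, exists_eq_or_imp, Tm.varOcc, Tm.outOcc]
      grind))
    simp only [substM, Multiset.map_cons, Multiset.cons_add] at e ⊢
    exact ⟨.parrI _ _ B C e⟩
  | @parrE Ψ₁ Ψ₂ Ψ₃ Δ₁ Δ₂ Δ₃ s y w B C d1 d2 d3 h12 h13 h23 ih1 ih2 ih3 =>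
    rintro Γ hΓ h
    have h1 : SeqDisj Φ ((t, some A) ::ₘ Θ) (Ψ₁) ((s, some (Ty.parr B C)) ::ₘ Δ₁) :=
      h.mono_right (by
        intro z
        simp only [UsedIn, Multiset.mem_cons, Multiset.mem_add, exists_eq_or_imp, Tm.varOcc,
          Tm.outOcc]
        grind)
    have h2 : SeqDisj Φ ((t, some A) ::ₘ Θ) ((y, B) ::ₘ Ψ₂) (Δ₂) :=
      h.mono_right (by
        intro z
        simp only [UsedIn, Multiset.mem_cons, Multiset.mem_add, exists_eq_or_imp, Tm.varOcc,
          Tm.outOcc]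
        grind)
    have h3 : SeqDisj Φ ((t, some A) ::ₘ Θ) ((w, C) ::ₘ Ψ₃) (Δ₃) :=
      h.mono_right (by
        intro z
        simp only [UsedIn, Multiset.mem_cons, Multiset.mem_add, exists_eq_or_imp, Tm.varOcc,
          Tm.outOcc]
        grind)
    rcases Multiset.cons_eq_add_cases hΓ with ⟨Γ', hΓ', rfl⟩ | ⟨Γ', rfl, rfl⟩
    · rcases Multiset.cons_eq_add_cases hΓ' with ⟨Γ', rfl, rfl⟩ | ⟨Γ', rfl, rfl⟩
      · obtain ⟨e⟩ := ih1 Γ' rfl h1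
        have hd2 := h2.substM_left h12
        have hd3 := h3.substM_left h13
        have hs2 := substM_eq_self (t := t) h12.not_usedIn
        have hs3 := substM_eq_self (t := t) h13.not_usedIn
        simp only [substM, Multiset.map_cons, Multiset.cons_add, Multiset.map_add]
          at e hd2 hd3 hs2 hs3 ⊢
        refine (NMLL.parrE _ y w B C e d2 d3 hd2 hd3 h23).nonempty_congr (by abel) ?_
        rw [Tm.subst, hs2, hs3]
        congr 1
        abel
      · rw [Multiset.cons_swap] at h12 h23 h2
        obtain ⟨e⟩ := ih2 ((y, B) ::ₘ Γ') (Multiset.cons_swap _ _ _)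
          (by rwa [Multiset.cons_swap])
        have hd1 := (h1.substM_left h12.symm).symm
        have hd3 := h3.substM_left h23
        obtain ⟨hu, hs1⟩ := subst_eq_self_of_cons (t := t) h12.symm.not_usedIn
        have hs3 := substM_eq_self (t := t) h23.not_usedIn
        simp only [substM, Multiset.map_cons, Multiset.cons_add, Multiset.map_add]
          at e hd1 hd3 hs1 hs3 ⊢
        refine (NMLL.parrE _ y w B C d1 e d3 hd1 h13 hd3).nonempty_congr (by abel) ?_
        rw [Tm.subst, hu, hs1, hs3]
        congr 1
        abel
    · rw [Multiset.cons_swap] at h13 h23 h3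
      obtain ⟨e⟩ := ih3 ((w, C) ::ₘ Γ') (Multiset.cons_swap _ _ _)
        (by rwa [Multiset.cons_swap])
      have hd1 := (h1.substM_left h13.symm).symm
      have hd2 := (h2.substM_left h23.symm).symm
      obtain ⟨hu, hs1⟩ := subst_eq_self_of_cons (t := t) h13.symm.not_usedIn
      have hs2 := substM_eq_self (t := t) h23.symm.not_usedIn
      simp only [substM, Multiset.map_cons, Multiset.cons_add, Multiset.map_add]
        at e hd1 hd2 hs1 hs2 ⊢
      refine (NMLL.parrE _ y w B C d1 d2 e h12 hd1 hd2).nonempty_congr (by abel) ?_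
      rw [Tm.subst, hu, hs1, hs2]
      congr 1
      abel
  | botI d' ih =>
    rintro Γ rfl h
    obtain ⟨e⟩ := ih Γ rfl (h.mono_right (by
      intro z
      simp only [UsedIn, Multiset.mem_cons, exists_eq_or_imp, Tm.varOcc, Tm.outOcc]
      grind))
    simp only [substM, Multiset.map_cons, Multiset.cons_add] at e ⊢
    exact ⟨.botI e⟩
  | botE u d' ih =>
    rintro Γ rfl h
    obtain ⟨e⟩ := ih Γ rfl (h.mono_right (by
      intro z
      simp only [UsedIn, Multiset.mem_cons, exists_eq_or_imp, Tm.varOcc, Tm.outOcc]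
      grind))
    simp only [substM, Multiset.map_cons, Multiset.cons_add] at e ⊢
    exact ⟨.botE _ e⟩

/-- Substitution Lemma. -/
theorem nmll_substitution {Φ Γ : Multiset (ℕ × Ty)} {Θ Δ : Multiset Entry}
    {t : Tm} {A : Ty} {x : ℕ}
    (d1 : NMLL Φ ((t, some A) ::ₘ Θ))
    (d2 : NMLL ((x, A) ::ₘ Γ) Δ)
    (h : SeqDisj Φ ((t, some A) ::ₘ Θ) ((x, A) ::ₘ Γ) Δ) :
    Nonempty (NMLL (Γ + Φ) (Δ.map (fun e => (Tm.subst x t e.1, e.2)) + Θ)) := by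
  exact NMLL.nonempty_subst d1 d2 Γ rfl h
end

section
/- Linearity of Channels, part 1: assume Γ ⇒ Δ is derivable in NMLL and x is a variable. If x occurs in Γ, then x occurs exactly once in Δ and the output operator x̄ does not occur in Δ. -/
/-- number of declarations of the variable x in the context Γ -/
def declCount (x : ℕ) (Γ : Multiset (ℕ × Ty)) : ℕ := (Γ.map Prod.fst).count x

theorem declCount_pos {x : ℕ} {Γ : Multiset (ℕ × Ty)} :
    0 < declCount x Γ ↔ ∃ A, (x, A) ∈ Γ := by
  simp [declCount, Multiset.count_pos]

theorem declCount_singleton (x y : ℕ) (A : Ty) :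
    declCount x {(y, A)} = if y = x then 1 else 0 := by
  simp [declCount, Multiset.count_singleton, eq_comm]

theorem declCount_cons (x y : ℕ) (A : Ty) (Γ : Multiset (ℕ × Ty)) :
    declCount x ((y, A) ::ₘ Γ) = (if y = x then 1 else 0) + declCount x Γ := by
  simp [declCount, Multiset.count_cons, eq_comm, add_comm]

theorem declCount_add (x : ℕ) (Γ Φ : Multiset (ℕ × Ty)) :
    declCount x (Γ + Φ) = declCount x Γ + declCount x Φ := by
  simp [declCount]

theorem varOccM_cons (x : ℕ) (e : Entry) (Δ : Multiset Entry) :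
    varOccM x (e ::ₘ Δ) = Tm.varOcc x e.1 + varOccM x Δ := by
  simp [varOccM]

theorem varOccM_add (x : ℕ) (Δ Θ : Multiset Entry) :
    varOccM x (Δ + Θ) = varOccM x Δ + varOccM x Θ := by
  simp [varOccM]

theorem outOccM_cons (x : ℕ) (e : Entry) (Δ : Multiset Entry) :
    outOccM x (e ::ₘ Δ) = Tm.outOcc x e.1 + outOccM x Δ := by
  simp [outOccM]

theorem outOccM_add (x : ℕ) (Δ Θ : Multiset Entry) :
    outOccM x (Δ + Θ) = outOccM x Δ + outOccM x Θ := by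
  simp [outOccM]

theorem occ_eq_zero_of_not_usedIn {x : ℕ} {Γ : Multiset (ℕ × Ty)} {Δ : Multiset Entry}
    (h : ¬ UsedIn Γ Δ x) : declCount x Γ = 0 ∧ varOccM x Δ = 0 ∧ outOccM x Δ = 0 := by
  rw [UsedIn, not_or, ← declCount_pos] at h
  obtain ⟨hΓ, hΔ⟩ := h
  push Not at hΔ
  refine ⟨by omega, ?_, ?_⟩
  · refine Multiset.sum_eq_zero fun n hn => ?_
    obtain ⟨e, he, rfl⟩ := Multiset.mem_map.1 hn
    exact Nat.le_zero.1 (hΔ e he).1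
  · refine Multiset.sum_eq_zero fun n hn => ?_
    obtain ⟨e, he, rfl⟩ := Multiset.mem_map.1 hn
    exact Nat.le_zero.1 (hΔ e he).2

theorem SeqDisj.occ_eq_zero {Γ Φ : Multiset (ℕ × Ty)} {Δ Θ : Multiset Entry}
    (h : SeqDisj Γ Δ Φ Θ) (x : ℕ) :
    (declCount x Γ = 0 ∧ varOccM x Δ = 0 ∧ outOccM x Δ = 0) ∨
      (declCount x Φ = 0 ∧ varOccM x Θ = 0 ∧ outOccM x Θ = 0) :=
  (not_and_or.1 (h x)).imp occ_eq_zero_of_not_usedIn occ_eq_zero_of_not_usedIn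

/-- Every variable is declared at most once, and a declared one is used exactly once, as an
input channel. -/
theorem NMLL.linear {Γ : Multiset (ℕ × Ty)} {Δ : Multiset Entry} (d : NMLL Γ Δ) (x : ℕ) :
    declCount x Γ ≤ 1 ∧ (0 < declCount x Γ → varOccM x Δ = 1 ∧ outOccM x Δ = 0) := by
  induction d with
  | ax y A =>
    rw [declCount_singleton]
    split_ifs with hy <;> simp [varOccM, outOccM, Tm.varOcc, Tm.outOcc, hy]
  | limpI y A B t d hy ih =>
    simp only [declCount_cons, varOccM_cons, outOccM_cons, Tm.varOcc, Tm.outOcc] at *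
    split_ifs at * <;> omega
  | limpE s t A B d₁ d₂ h ih₁ ih₂ =>
    have h := h.occ_eq_zero x
    simp only [declCount_add, varOccM_cons, outOccM_cons, varOccM_add, outOccM_add,
      Tm.varOcc, Tm.outOcc] at *
    omega
  | parrI s t A B d ih =>
    simp only [varOccM_cons, outOccM_cons, Tm.varOcc, Tm.outOcc] at *
    omega
  | parrE s y z A B d₁ d₂ d₃ h₁₂ h₁₃ h₂₃ ih₁ ih₂ ih₃ =>
    have h₁₂ := h₁₂.occ_eq_zero x
    have h₁₃ := h₁₃.occ_eq_zero x
    have h₂₃ := h₂₃.occ_eq_zero x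
    simp only [declCount_add, declCount_cons, varOccM_cons, outOccM_cons, varOccM_add,
      outOccM_add, Tm.varOcc, Tm.outOcc] at *
    split_ifs at * <;> omega
  | botI d ih =>
    simpa only [varOccM_cons, outOccM_cons, Tm.varOcc, Tm.outOcc, zero_add] using ih
  | botE t d ih =>
    simpa only [varOccM_cons, outOccM_cons, Tm.varOcc, Tm.outOcc] using ih

/-- Linearity of Channels, part 1. -/
theorem linearity_of_channels_one {Γ : Multiset (ℕ × Ty)} {Δ : Multiset Entry}
    (d : NMLL Γ Δ) (x : ℕ) (hx : ∃ A, (x, A) ∈ Γ) :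
    varOccM x Δ = 1 ∧ outOccM x Δ = 0 :=
  (d.linear x).2 (declCount_pos.2 hx)
end

section
/- Simple-context channel separation: suppose Φ ⇒ C[u]:F, Π or Φ ⇒ C[u], Π is derivable in NMLL, where C[ ] is a simple context. If the output binder z̄ occurs in u, then the variable z does not occur in C[ ]. -/
/-- in every application occurring in the term, no channel is output on one side and
read on the other -/
def Tm.AppSeparated : Tm → Prop
  | .unit => True
  | .out _ u => AppSeparated u
  | .out2 _ _ u => AppSeparated u
  | .par u v => AppSeparated u ∧ AppSeparated v
  | .close u => AppSeparated u
  | .var _ => True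
  | .app u v => AppSeparated u ∧ AppSeparated v ∧
      ∀ z, (0 < outOcc z u → varOcc z v = 0) ∧ (0 < outOcc z v → varOcc z u = 0)

theorem NMLL.appSeparated {Γ : Multiset (ℕ × Ty)} {Δ : Multiset Entry} (d : NMLL Γ Δ) :
    ∀ e ∈ Δ, e.1.AppSeparated := by
  induction d with
  | ax x A => simp [Tm.AppSeparated]
  | limpI x A B t d hx ih =>
    simp only [Multiset.forall_mem_cons, Tm.AppSeparated] at ih ⊢
    exact ih
  | limpE s t A B d1 d2 h ih1 ih2 =>
    simp only [Multiset.forall_mem_cons, Multiset.mem_add, Tm.AppSeparated] at ih1 ih2 ⊢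
    refine ⟨⟨ih1.1, ih2.1, fun z => ⟨fun ho => ?_, fun ho => ?_⟩⟩,
      fun e he => he.elim (ih1.2 e) (ih2.2 e)⟩
    · by_contra hv
      exact h z ⟨Or.inr ⟨_, Multiset.mem_cons_self _ _, Or.inr ho⟩,
        Or.inr ⟨_, Multiset.mem_cons_self _ _, Or.inl (Nat.pos_of_ne_zero hv)⟩⟩
    · by_contra hv
      exact h z ⟨Or.inr ⟨_, Multiset.mem_cons_self _ _, Or.inl (Nat.pos_of_ne_zero hv)⟩,
        Or.inr ⟨_, Multiset.mem_cons_self _ _, Or.inr ho⟩⟩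
  | parrI s t A B d ih =>
    simp only [Multiset.forall_mem_cons, Tm.AppSeparated] at ih ⊢
    exact ⟨⟨ih.1, ih.2.1⟩, ih.2.2⟩
  | parrE s x y A B d1 d2 d3 h12 h13 h23 ih1 ih2 ih3 =>
    simp only [Multiset.forall_mem_cons, Multiset.mem_add, Tm.AppSeparated] at ih1 ⊢
    exact ⟨ih1.1, fun e he => he.elim (fun he => he.elim (ih1.2 e) (ih2 e)) (ih3 e)⟩
  | botI d ih =>
    simp only [Multiset.forall_mem_cons, Tm.AppSeparated]
    exact ⟨trivial, ih⟩
  | botE t d ih =>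
    simp only [Multiset.forall_mem_cons, Tm.AppSeparated] at ih ⊢
    exact ih

theorem Ctx.outOcc_le_outOcc_fill (z : ℕ) (C : Ctx) (u : Tm) :
    Tm.outOcc z u ≤ Tm.outOcc z (C.fill u) := by
  induction C <;> simp only [Ctx.fill, Tm.outOcc] <;> omega

theorem Ctx.Simple.varOcc_eq_zero {C : Ctx} {u : Tm} {z : ℕ} (hC : C.Simple)
    (hsep : (C.fill u).AppSeparated) (hz : 0 < Tm.outOcc z u) : C.varOcc z = 0 := by
  induction C with
  | hole => rfl
  | out _ C ih => exact ih hC hsep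
  | out2 _ _ C ih => exact ih hC hsep
  | parL => exact hC.elim
  | parR => exact hC.elim
  | close C ih => exact ih hC hsep
  | appL C w ih =>
    obtain ⟨hl, -, hd⟩ := hsep
    have hw := (hd z).1 (hz.trans_le (C.outOcc_le_outOcc_fill z u))
    simp [Ctx.varOcc, ih hC hl, hw]
  | appR w C ih =>
    obtain ⟨-, hr, hd⟩ := hsep
    have hw := (hd z).2 (hz.trans_le (C.outOcc_le_outOcc_fill z u))
    simp [Ctx.varOcc, ih hC hr, hw]

/-- Simple-context channel separation. -/
theorem simple_context_separation {Φ : Multiset (ℕ × Ty)} {Ψ : Multiset Entry}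
    {C : Ctx} {u : Tm} {F : Option Ty} {z : ℕ}
    (d : NMLL Φ ((C.fill u, F) ::ₘ Ψ))
    (hC : C.Simple) (hz : 0 < Tm.outOcc z u) :
    Ctx.varOcc z C = 0 := by
  exact hC.varOcc_eq_zero (d.appSeparated _ (Multiset.mem_cons_self _ _)) hz
end
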